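/- For every δ ∈ (−1,1) and every Borel set B ⊆ [0,1]², λ(Ψ_δ(B)) = (1+δ)·λ(B ∩ ([0,1/2]×[0,1])) + (1−δ)·λ(B ∩ ([1/2,1]×[0,1])). In particular, for the left half Λ_L = [0,1/2]×[0,1] one has λ(Ψ_δ(Λ_L)) = (1+δ)·λ(Λ_L) = (1+δ)/2. -/

import Mathlib

open MeasureTheory Set Filter

noncomputable section

/-- The closed unit square `[0,1]²` in the plane `ℝ × ℝ`. -/
def unitSq : Set (ℝ × ℝ) := Set.Icc (0:ℝ) 1 ×ˢ Set.Icc (0:ℝ) 1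

/-- The topological boundary of the unit square. -/
def unitSqBdry : Set (ℝ × ℝ) :=
  {x ∈ unitSq | x.1 = 0 ∨ x.1 = 1 ∨ x.2 = 0 ∨ x.2 = 1}

/-- The domain `[0,1] × [0,1/2) \ {(1/2,0)}` of the parametrisation `K`. -/
def lowerDom : Set (ℝ × ℝ) :=
  (Set.Icc (0:ℝ) 1 ×ˢ Set.Ico (0:ℝ) (1/2)) \ {((1/2 : ℝ), (0 : ℝ))}

/-- The hypotheses on the auxiliary function `h : [0,1/2) → [0,∞)`. -/
def GoodH (h : ℝ → ℝ) : Prop :=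
  (∀ r ∈ Set.Ico (0:ℝ) (1/2), 0 ≤ h r) ∧
  MonotoneOn h (Set.Ico (0:ℝ) (1/2)) ∧
  (∀ r ∈ Set.Icc (0:ℝ) (1/10), h r = 0) ∧
  Filter.Tendsto h (nhdsWithin (1/2 : ℝ) (Set.Iio (1/2 : ℝ))) Filter.atTop ∧
  ContDiffOn ℝ 3 h (Set.Ico (0:ℝ) (1/2)) ∧
  ∃ c : ℝ, ∀ r ∈ Set.Ico (0:ℝ) (1/2),
    (deriv h r) ^ 2 ≤ c * (r + h r) ^ 3 ∧
    deriv (deriv h) r * deriv h r ≤ c * (r + h r) ^ 3 ∧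
    |deriv (deriv (deriv h)) r| ≤ c * (r + h r) ^ 2

/-- The defining property of the angle function `Θ`. -/
def GoodTheta (h : ℝ → ℝ) (r₀ : ℝ) (Θ : ℝ → ℝ) : Prop :=
  (∀ r : ℝ, 0 < r → r ≤ r₀ → Θ r = Real.arccos (h r / (h r + r))) ∧
  (∀ r : ℝ, r₀ < r → r < 1/2 → Θ r = Real.arcsin (1 / (2 * (h r + r))))

/-- The defining property of the `r-θ` parametrisation `K`. -/
def GoodK (h Θ : ℝ → ℝ) (K : ℝ × ℝ → ℝ × ℝ) : Prop :=
  Set.BijOn K lowerDom (Set.Ioo (0:ℝ) (1/2) ×ˢ Set.Icc (-1:ℝ) 1) ∧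
  ∀ x ∈ lowerDom,
    x.1 = 1/2 + ((K x).1 + h (K x).1) * Real.sin ((K x).2 * Θ (K x).1) ∧
    x.2 = ((K x).1 + h (K x).1) * Real.cos ((K x).2 * Θ (K x).1) - h (K x).1

/-- The weight function `w_r(θ) = 1 + h'(r) − h'(r) cos(θ Θ(r))`. -/
def wgt (h Θ : ℝ → ℝ) (r θ : ℝ) : ℝ :=
  1 + deriv h r - deriv h r * Real.cos (θ * Θ r)

/-- The defining properties of the family of stretching bijections `g_r`. -/
def IsGFamily (h Θ : ℝ → ℝ) (δ : ℝ) (g : ℝ → ℝ → ℝ) : Prop :=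
  ∀ r ∈ Set.Ioo (0:ℝ) (1/2),
    StrictMonoOn (g r) (Set.Icc (-1:ℝ) 1) ∧
    Set.BijOn (g r) (Set.Icc (-1:ℝ) 1) (Set.Icc (-1:ℝ) 1) ∧
    g r (-1) = -1 ∧ g r 1 = 1 ∧
    (∀ ℓ ∈ Set.Icc (-1:ℝ) 0,
      (1 + δ) * ∫ θ in (-1:ℝ)..ℓ, wgt h Θ r θ = ∫ θ in (-1:ℝ)..(g r ℓ), wgt h Θ r θ) ∧
    (∀ ℓ ∈ Set.Icc (0:ℝ) 1,
      (1 - δ) * ∫ θ in ℓ..(1:ℝ), wgt h Θ r θ = ∫ θ in (g r ℓ)..(1:ℝ), wgt h Θ r θ)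

/-- The defining properties of the map `Ψ_δ` in terms of `K` and the family `g`. -/
def IsPsi (K : ℝ × ℝ → ℝ × ℝ) (δ : ℝ) (g : ℝ → ℝ → ℝ) (Ψ : ℝ × ℝ → ℝ × ℝ) : Prop :=
  (∀ x ∈ lowerDom, Ψ x ∈ lowerDom ∧ (K (Ψ x)).1 = (K x).1 ∧
      (K (Ψ x)).2 = g (K x).1 (K x).2) ∧
  Ψ (1/2, 0) = (1/2, 0) ∧
  (∀ x ∈ unitSq, 1/2 < x.2 → Ψ x = ((Ψ (x.1, 1 - x.2)).1, 1 - (Ψ (x.1, 1 - x.2)).2)) ∧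
  (∀ x₁ : ℝ, 0 ≤ x₁ → x₁ ≤ 1/2 → Ψ (x₁, 1/2) = ((1 + δ) * x₁, 1/2)) ∧
  (∀ x₁ : ℝ, 1/2 ≤ x₁ → x₁ ≤ 1 → Ψ (x₁, 1/2) = ((1 + δ)/2 + (1 - δ) * (x₁ - 1/2), 1/2))

/-- The left half `[0,1/2] × [0,1]` of the unit square. -/
def leftHalf : Set (ℝ × ℝ) := Set.Icc (0:ℝ) (1/2) ×ˢ Set.Icc (0:ℝ) 1

/-- The right half `[1/2,1] × [0,1]` of the unit square. -/
def rightHalf : Set (ℝ × ℝ) := Set.Icc (1/2:ℝ) 1 ×ˢ Set.Icc (0:ℝ) 1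

/-- Polar-type parametrisation in the coordinates `(r, φ)`. -/
def polF (η : ℝ → ℝ) (p : ℝ × ℝ) : ℝ × ℝ :=
  (1/2 + (p.1 + η p.1) * Real.sin p.2, (p.1 + η p.1) * Real.cos p.2 - η p.1)

/-- Passage from the angle `φ` to the area coordinate `u`. -/
def areaQ (d : ℝ → ℝ) (p : ℝ × ℝ) : ℝ × ℝ :=
  (p.1, (1 + d p.1) * p.2 - d p.1 * Real.sin p.2)

/-- The parameter domain in the `(r, φ)` coordinates. -/
def polS (T : ℝ → ℝ) : Set (ℝ × ℝ) := {p | p.1 ∈ Ioo (0:ℝ) (1/2) ∧ |p.2| ≤ T p.1}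

/-- Fibrewise affine map. -/
def shearL (a : ℝ) (m : ℝ → ℝ) (p : ℝ × ℝ) : ℝ × ℝ := (p.1, a * p.2 + m p.1)

/-- derivative of `polF` -/
def dPolF (η d : ℝ → ℝ) (p : ℝ × ℝ) : ℝ × ℝ →L[ℝ] ℝ × ℝ :=
  (Matrix.toLin (.finTwoProd ℝ) (.finTwoProd ℝ)
    !![(1 + d p.1) * Real.sin p.2, (p.1 + η p.1) * Real.cos p.2;
      (1 + d p.1) * Real.cos p.2 - d p.1, -((p.1 + η p.1) * Real.sin p.2)]).toContinuousLinearMap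

/-- derivative of `areaQ` -/
def dAreaQ (d e : ℝ → ℝ) (p : ℝ × ℝ) : ℝ × ℝ →L[ℝ] ℝ × ℝ :=
  (Matrix.toLin (.finTwoProd ℝ) (.finTwoProd ℝ)
    !![1, 0; e p.1 * p.2 - e p.1 * Real.sin p.2,
      (1 + d p.1) - d p.1 * Real.cos p.2]).toContinuousLinearMap

theorem hasFDerivAt_polF (η d : ℝ → ℝ) (p : ℝ × ℝ) (hp : HasDerivAt η (d p.1) p.1) :
    HasFDerivAt (polF η) (dPolF η d p) p := by
  unfold dPolF
  rw [Matrix.toLin_finTwoProd_toContinuousLinearMap]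
  have hη : HasFDerivAt (fun q : ℝ × ℝ => η q.1) _ p := 
    hp.comp_hasFDerivAt (f := Prod.fst) p (hasFDerivAt_fst (𝕜 := ℝ) (E := ℝ) (F := ℝ))
  have hsin : HasFDerivAt (fun q : ℝ × ℝ => Real.sin q.2) _ p :=
    (Real.hasDerivAt_sin p.2).comp_hasFDerivAt (f := Prod.snd) p
      (hasFDerivAt_snd (𝕜 := ℝ) (E := ℝ) (F := ℝ))
  have hcos : HasFDerivAt (fun q : ℝ × ℝ => Real.cos q.2) _ p :=
    (Real.hasDerivAt_cos p.2).comp_hasFDerivAt (f := Prod.snd) p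
      (hasFDerivAt_snd (𝕜 := ℝ) (E := ℝ) (F := ℝ))
  have hR : HasFDerivAt (fun q : ℝ × ℝ => q.1 + η q.1) _ p := hasFDerivAt_fst.add hη
  have := HasFDerivAt.prodMk (𝕜 := ℝ) ((hR.mul hsin).const_add (1/2)) ((hR.mul hcos).sub hη)
  refine this.congr_fderiv ?_
  ext <;> simp <;> ring

theorem hasFDerivAt_areaQ (d e : ℝ → ℝ) (p : ℝ × ℝ) (hp : HasDerivAt d (e p.1) p.1) :
    HasFDerivAt (areaQ d) (dAreaQ d e p) p := by
  unfold dAreaQ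
  rw [Matrix.toLin_finTwoProd_toContinuousLinearMap]
  have hd : HasFDerivAt (fun q : ℝ × ℝ => d q.1) _ p := 
    hp.comp_hasFDerivAt (f := Prod.fst) p (hasFDerivAt_fst (𝕜 := ℝ) (E := ℝ) (F := ℝ))
  have hsin : HasFDerivAt (fun q : ℝ × ℝ => Real.sin q.2) _ p :=
    (Real.hasDerivAt_sin p.2).comp_hasFDerivAt (f := Prod.snd) p
      (hasFDerivAt_snd (𝕜 := ℝ) (E := ℝ) (F := ℝ))
  have := HasFDerivAt.prodMk (𝕜 := ℝ) (hasFDerivAt_fst (p := p) (𝕜 := ℝ) (E := ℝ) (F := ℝ))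
    (((hd.const_add 1).mul hasFDerivAt_snd).sub (hd.mul hsin))
  refine this.congr_fderiv ?_
  ext <;> simp <;> ring

theorem det_dPolF (η d : ℝ → ℝ) (p : ℝ × ℝ) :
    (dPolF η d p).det = -((p.1 + η p.1) * (1 + d p.1 - d p.1 * Real.cos p.2)) := by
  unfold dPolF
  simp only [LinearMap.det_toContinuousLinearMap, LinearMap.det_toLin, Matrix.det_fin_two_of]
  linear_combination (-(p.1 + η p.1) * (1 + d p.1)) * Real.sin_sq_add_cos_sq p.2

theorem det_dAreaQ (d e : ℝ → ℝ) (p : ℝ × ℝ) :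
    (dAreaQ d e p).det = 1 + d p.1 - d p.1 * Real.cos p.2 := by
  unfold dAreaQ
  simp only [LinearMap.det_toContinuousLinearMap, LinearMap.det_toLin, Matrix.det_fin_two_of]
  ring

theorem areaQ_injOn (d : ℝ → ℝ) (T : ℝ → ℝ) (hd : ∀ r ∈ Ioo (0:ℝ) (1/2), 0 ≤ d r) :
    InjOn (areaQ d) (polS T) := by
  rintro ⟨r, x⟩ ⟨hr, -⟩ ⟨r', y⟩ - hxy
  simp only [areaQ, Prod.mk.injEq] at hxy
  obtain ⟨rfl, h2⟩ := hxy
  have h0 := hd r hr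
  have h1 := Real.abs_sin_sub_sin_le x y
  have h3 : (1 + d r) * |x - y| ≤ d r * |x - y| := by
    calc (1 + d r) * |x - y| = |(1 + d r) * (x - y)| := by
          rw [abs_mul, abs_of_nonneg (by linarith : 0 ≤ 1 + d r)]
      _ = |d r * (Real.sin x - Real.sin y)| := by congr 1; linarith
      _ = d r * |Real.sin x - Real.sin y| := by rw [abs_mul, abs_of_nonneg h0]
      _ ≤ _ := by gcongr
  have h4 : |x - y| ≤ 0 := by linarith
  have h5 : x - y = 0 := abs_nonpos_iff.1 h4
  simp; linarith

theorem measurableSet_polS {T : ℝ → ℝ} (hT : Measurable T) : MeasurableSet (polS T) := by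
  unfold polS
  apply MeasurableSet.inter
  · exact measurable_fst measurableSet_Ioo
  · exact measurableSet_le (f := fun p : ℝ × ℝ => |p.2|) (g := fun p : ℝ × ℝ => T p.1)
      (measurable_snd.abs) (hT.comp measurable_fst)

theorem volume_polF_image {η d e T : ℝ → ℝ}
    (hη0 : ∀ r ∈ Ioo (0:ℝ) (1/2), 0 ≤ η r) (hd0 : ∀ r ∈ Ioo (0:ℝ) (1/2), 0 ≤ d r)
    (hη : ∀ r ∈ Ioo (0:ℝ) (1/2), HasDerivAt η (d r) r)
    (hd : ∀ r ∈ Ioo (0:ℝ) (1/2), HasDerivAt d (e r) r)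
    (hF : InjOn (polF η) (polS T)) {A : Set (ℝ × ℝ)} (hA : MeasurableSet A) (hAS : A ⊆ polS T) :
    volume (polF η '' A) = ∫⁻ p in areaQ d '' A, ENNReal.ofReal (p.1 + η p.1) := by
  rw [← lintegral_abs_det_fderiv_eq_addHaar_image volume hA
    (fun p hp => (hasFDerivAt_polF η d p (hη _ (hAS hp).1)).hasFDerivWithinAt) (hF.mono hAS),
    lintegral_image_eq_lintegral_abs_det_fderiv_mul volume hA
    (fun p hp => (hasFDerivAt_areaQ d e p (hd _ (hAS hp).1)).hasFDerivWithinAt)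
    ((areaQ_injOn d T hd0).mono hAS)]
  refine setLIntegral_congr_fun hA (fun p hp => ?_)
  have h1 := hη0 _ (hAS hp).1
  have h2 := hd0 _ (hAS hp).1
  have h3 := (hAS hp).1.1
  have h4 : 0 ≤ 1 + d p.1 - d p.1 * Real.cos p.2 := by
    nlinarith [Real.cos_le_one p.2]
  simp only [det_dPolF, det_dAreaQ, areaQ]
  rw [abs_neg, abs_mul, abs_of_nonneg h4, abs_of_nonneg (by linarith : 0 ≤ p.1 + η p.1),
    mul_comm, ENNReal.ofReal_mul h4]

theorem shearL_inj (a : ℝ) (ha : 0 < a) (m : ℝ → ℝ) : Function.Injective (shearL a m) := by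
  rintro ⟨r, x⟩ ⟨r', y⟩ hxy
  simp only [shearL, Prod.mk.injEq] at hxy
  obtain ⟨rfl, h2⟩ := hxy
  have : a * x = a * y := by linarith
  simp [mul_left_cancel₀ ha.ne' this]

theorem measurable_shearL (a : ℝ) {m : ℝ → ℝ} (hm : Measurable m) : Measurable (shearL a m) := by
  unfold shearL; fun_prop

open scoped Pointwise in
theorem lintegral_shearL_image {a : ℝ} (ha : 0 < a) {m : ℝ → ℝ} (hm : Measurable m)
    {ρ : ℝ → ENNReal} (hρ : Measurable ρ) {E : Set (ℝ × ℝ)} (hE : MeasurableSet E) :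
    ∫⁻ p in shearL a m '' E, ρ p.1 = ENNReal.ofReal a * ∫⁻ p in E, ρ p.1 := by
  have hLE : MeasurableSet (shearL a m '' E) :=
    hE.image_of_measurable_injOn (measurable_shearL a hm) (shearL_inj a ha m).injOn
  rw [← withDensity_apply _ hLE, ← withDensity_apply _ hE, Measure.volume_eq_prod,
    ← prod_withDensity_left hρ, Measure.prod_apply hLE, Measure.prod_apply hE,
    ← lintegral_const_mul _ (measurable_measure_prodMk_left hE)]
  refine lintegral_congr fun r => ?_
  have : Prod.mk r ⁻¹' (shearL a m '' E) = (fun y => y + m r) '' (a • (Prod.mk r ⁻¹' E)) := by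
    ext y
    simp only [mem_preimage, mem_image, shearL, Prod.mk.injEq, Prod.exists, mem_smul_set]
    constructor
    · rintro ⟨r', x, h1, rfl, rfl⟩
      exact ⟨_, ⟨x, h1, rfl⟩, rfl⟩
    · rintro ⟨_, ⟨x, h1, rfl⟩, rfl⟩
      exact ⟨r, x, h1, rfl, rfl⟩
  rw [this, image_add_right, measure_preimage_add_right, Measure.addHaar_smul_of_nonneg _ ha.le]
  simp

theorem measurable_polF {η : ℝ → ℝ} (hη : Measurable η) : Measurable (polF η) := by
  unfold polF; fun_prop

theorem measurable_areaQ {d : ℝ → ℝ} (hd : Measurable d) : Measurable (areaQ d) := by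
  unfold areaQ; fun_prop

theorem key_volume {η d e T m : ℝ → ℝ} {a : ℝ} (ha : 0 < a)
    (hηm : Measurable η) (hdm : Measurable d) (hTm : Measurable T) (hm : Measurable m)
    (hη0 : ∀ r ∈ Ioo (0:ℝ) (1/2), 0 ≤ η r) (hd0 : ∀ r ∈ Ioo (0:ℝ) (1/2), 0 ≤ d r)
    (hη : ∀ r ∈ Ioo (0:ℝ) (1/2), HasDerivAt η (d r) r)
    (hd : ∀ r ∈ Ioo (0:ℝ) (1/2), HasDerivAt d (e r) r)
    (hF : InjOn (polF η) (polS T)) {B : Set (ℝ × ℝ)} (hB : MeasurableSet B)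
    (hBS : B ⊆ polF η '' polS T) (Ψ : ℝ × ℝ → ℝ × ℝ)
    (hΨ : ∀ p ∈ polS T, polF η p ∈ B →
      ∃ q ∈ polS T, polF η q = Ψ (polF η p) ∧ areaQ d q = shearL a m (areaQ d p)) :
    MeasurableSet (Ψ '' B) ∧ volume (Ψ '' B) = ENNReal.ofReal a * volume B := by
  have hS := measurableSet_polS hTm
  have hQ := areaQ_injOn d T hd0
  set A := polS T ∩ polF η ⁻¹' B with hAdef
  have hA : MeasurableSet A := hS.inter (measurable_polF hηm hB)
  have hAS : A ⊆ polS T := inter_subset_left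
  have hQA : MeasurableSet (areaQ d '' A) :=
    hA.image_of_measurable_injOn (measurable_areaQ hdm) (hQ.mono hAS)
  have hLQA : MeasurableSet (shearL a m '' (areaQ d '' A)) :=
    hQA.image_of_measurable_injOn (measurable_shearL a hm) (shearL_inj a ha m).injOn
  set A' := polS T ∩ areaQ d ⁻¹' (shearL a m '' (areaQ d '' A)) with hA'def
  have hA' : MeasurableSet A' := hS.inter (measurable_areaQ hdm hLQA)
  have hA'S : A' ⊆ polS T := inter_subset_left
  have hFA : polF η '' A = B := by
    ext x; constructor
    · rintro ⟨p, hp, rfl⟩; exact hp.2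
    · intro hx
      obtain ⟨p, hp, rfl⟩ := hBS hx
      exact ⟨p, ⟨hp, hx⟩, rfl⟩
  have hQA' : areaQ d '' A' = shearL a m '' (areaQ d '' A) := by
    ext x; constructor
    · rintro ⟨p, hp, rfl⟩; exact hp.2
    · rintro ⟨_, ⟨p, hp, rfl⟩, rfl⟩
      obtain ⟨q, hq, -, h2⟩ := hΨ p hp.1 hp.2
      exact ⟨q, ⟨hq, _, ⟨p, hp, rfl⟩, h2.symm⟩, h2⟩
  have hΨB : Ψ '' B = polF η '' A' := by
    rw [← hFA]
    ext x; constructor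
    · rintro ⟨_, ⟨p, hp, rfl⟩, rfl⟩
      obtain ⟨q, hq, h1, h2⟩ := hΨ p hp.1 hp.2
      exact ⟨q, ⟨hq, _, ⟨p, hp, rfl⟩, h2.symm⟩, h1⟩
    · rintro ⟨q, ⟨hq, _, ⟨p, hp, rfl⟩, h2⟩, rfl⟩
      obtain ⟨q', hq', h1, h3⟩ := hΨ p hp.1 hp.2
      have : q = q' := hQ hq hq' (by rw [h3, h2])
      exact ⟨_, ⟨p, hp, rfl⟩, by rw [this, h1]⟩
  constructor
  · rw [hΨB]
    exact hA'.image_of_measurable_injOn (measurable_polF hηm) (hF.mono hA'S)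
  · rw [hΨB, volume_polF_image hη0 hd0 hη hd hF hA' hA'S, hQA',
      lintegral_shearL_image ha hm (ρ := fun r => ENNReal.ofReal (r + η r)) (by fun_prop) hQA,
      ← volume_polF_image hη0 hd0 hη hd hF hA hAS, hFA]

theorem line_fst_null (c : ℝ) : volume {x : ℝ × ℝ | x.1 = c} = 0 := by
  have : {x : ℝ × ℝ | x.1 = c} = {c} ×ˢ univ := by ext; simp
  rw [this, Measure.volume_eq_prod, Measure.prod_prod]; simp

theorem line_snd_null (c : ℝ) : volume {x : ℝ × ℝ | x.2 = c} = 0 := by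
  have : {x : ℝ × ℝ | x.2 = c} = univ ×ˢ {c} := by ext; simp
  rw [this, Measure.volume_eq_prod, Measure.prod_prod]; simp

/-- Vertical reflection. -/
def reflV (x : ℝ × ℝ) : ℝ × ℝ := (x.1, 1 - x.2)

theorem reflV_reflV (x : ℝ × ℝ) : reflV (reflV x) = x := by simp [reflV]

theorem reflV_image (A : Set (ℝ × ℝ)) : reflV '' A = reflV ⁻¹' A :=
  congrFun (Set.image_eq_preimage_of_inverse reflV_reflV reflV_reflV) A

theorem measurable_reflV : Measurable reflV := by unfold reflV; fun_prop

theorem reflV_mp : MeasurePreserving reflV := by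
  have := (MeasurePreserving.id (volume : Measure ℝ)).prod
    (Measure.measurePreserving_sub_left (volume : Measure ℝ) 1)
  exact this

theorem volume_reflV (A : Set (ℝ × ℝ)) : volume (reflV '' A) = volume A := by
  let e : ℝ × ℝ ≃ᵐ ℝ × ℝ := ⟨⟨reflV, reflV, reflV_reflV, reflV_reflV⟩,
    measurable_reflV, measurable_reflV⟩
  rw [reflV_image]
  exact reflV_mp.measure_preimage_emb e.measurableEmbedding A

theorem exists_measurable_h {h : ℝ → ℝ} (hh : GoodH h) :
    ∃ η : ℝ → ℝ, Measurable η ∧ (∀ r ∈ Ioo (0:ℝ) (1/2), η r = h r) ∧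
      (∀ r ∈ Ioo (0:ℝ) (1/2), HasDerivAt η (deriv h r) r) ∧
      (∀ r ∈ Ioo (0:ℝ) (1/2), HasDerivAt (deriv h) (deriv (deriv h) r) r) ∧
      (∀ r ∈ Ioo (0:ℝ) (1/2), 0 ≤ deriv h r) := by
  classical
  obtain ⟨h0, hmono, -, -, hC, -⟩ := hh
  have hC' : ContDiffOn ℝ 3 h (Ioo (0:ℝ) (1/2)) := hC.mono Ioo_subset_Ico_self
  refine ⟨(Ioo (0:ℝ) (1/2)).piecewise h 0, ?_, ?_, ?_, ?_, ?_⟩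
  · exact hC'.continuousOn.measurable_piecewise continuousOn_const measurableSet_Ioo
  · intro r hr; exact Set.piecewise_eq_of_mem _ _ _ hr
  · intro r hr
    have hn : Ioo (0:ℝ) (1/2) ∈ nhds r := isOpen_Ioo.mem_nhds hr
    have hd : DifferentiableAt ℝ h r :=
      (hC'.contDiffAt hn).differentiableAt (by norm_num)
    refine hd.hasDerivAt.congr_of_eventuallyEq ?_
    filter_upwards [hn] with y hy
    exact Set.piecewise_eq_of_mem _ _ _ hy
  · intro r hr
    have hn : Ioo (0:ℝ) (1/2) ∈ nhds r := isOpen_Ioo.mem_nhds hr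
    have h2 : ContDiffOn ℝ 2 (deriv h) (Ioo (0:ℝ) (1/2)) :=
      hC'.deriv_of_isOpen isOpen_Ioo (by norm_num)
    exact ((h2.contDiffAt hn).differentiableAt (by norm_num)).hasDerivAt
  · intro r hr
    have := (hmono.mono Ioo_subset_Ico_self).derivWithin_nonneg (x := r)
    rwa [derivWithin_of_isOpen isOpen_Ioo hr] at this

theorem exists_measurable_Theta {h η Θ : ℝ → ℝ} {r₀ : ℝ} (hη0 : ∀ r ∈ Ioo (0:ℝ) (1/2), 0 ≤ η r)
    (hηm : Measurable η) (hηh : ∀ r ∈ Ioo (0:ℝ) (1/2), η r = h r)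
    (hΘ : GoodTheta h r₀ Θ) :
    ∃ T : ℝ → ℝ, Measurable T ∧ (∀ r ∈ Ioo (0:ℝ) (1/2), T r = Θ r) ∧
      (∀ r ∈ Ioo (0:ℝ) (1/2), 0 < T r) ∧ (∀ r ∈ Ioo (0:ℝ) (1/2), T r ≤ Real.pi / 2) := by
  refine ⟨fun r => if r ≤ r₀ then Real.arccos (η r / (η r + r))
    else Real.arcsin (1 / (2 * (η r + r))), ?_, ?_, ?_, ?_⟩
  · refine Measurable.ite measurableSet_Iic ?_ ?_
    · exact Real.continuous_arccos.measurable.comp (by fun_prop)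
    · exact Real.continuous_arcsin.measurable.comp (by fun_prop)
  · intro r hr
    dsimp only
    split_ifs with h1
    · rw [hΘ.1 r hr.1 h1, hηh r hr]
    · rw [hΘ.2 r (not_le.1 h1) hr.2, hηh r hr]
  · intro r hr
    have h2 := hη0 r hr
    have h3 := hr.1
    dsimp only
    split_ifs with h1
    · rw [Real.arccos_pos, div_lt_one (by linarith)]; linarith
    · rw [Real.arcsin_pos]; positivity
  · intro r hr
    have h2 := hη0 r hr
    have h3 := hr.1
    dsimp only
    split_ifs with h1
    · rw [Real.arccos_le_pi_div_two]; positivity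
    · exact Real.arcsin_le_pi_div_two _

theorem integral_wgt {h Θ : ℝ → ℝ} {r : ℝ} (a b : ℝ) :
    Θ r * ∫ θ in a..b, wgt h Θ r θ =
      ((1 + deriv h r) * (b * Θ r) - deriv h r * Real.sin (b * Θ r)) -
      ((1 + deriv h r) * (a * Θ r) - deriv h r * Real.sin (a * Θ r)) := by
  rw [← intervalIntegral.integral_const_mul]
  rw [intervalIntegral.integral_eq_sub_of_hasDerivAt (f := fun θ =>
    (1 + deriv h r) * (θ * Θ r) - deriv h r * Real.sin (θ * Θ r))]
  · intro x _
    have h1 : HasDerivAt (fun θ => θ * Θ r) (Θ r) x := by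
      simpa using (hasDerivAt_id x).mul_const (Θ r)
    have := (h1.const_mul (1 + deriv h r)).sub (h1.sin.const_mul (deriv h r))
    refine this.congr_deriv ?_
    unfold wgt; ring
  · apply Continuous.intervalIntegrable
    unfold wgt; fun_prop

/-- The main computation on the lower half. -/
theorem lower_main (h : ℝ → ℝ) (hh : GoodH h)
    (r₀ : ℝ) (Θ : ℝ → ℝ) (hΘ : GoodTheta h r₀ Θ)
    (K : ℝ × ℝ → ℝ × ℝ) (hK : GoodK h Θ K)
    (δ : ℝ) (hδ : δ ∈ Set.Ioo (-1:ℝ) 1)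
    (g : ℝ → ℝ → ℝ) (hg : IsGFamily h Θ δ g)
    (Ψ : ℝ × ℝ → ℝ × ℝ) (hΨ : IsPsi K δ g Ψ)
    (B : Set (ℝ × ℝ)) (hBl : B ⊆ lowerDom) (hB : MeasurableSet B) :
    volume (Ψ '' B) = ENNReal.ofReal (1 + δ) * volume (B ∩ {x | x.1 ≤ 1/2})
        + ENNReal.ofReal (1 - δ) * volume (B ∩ {x | 1/2 < x.1}) := by
  obtain ⟨η, hηm, hηh, hη, hd, hd0⟩ := exists_measurable_h hh
  have hη0 : ∀ r ∈ Ioo (0:ℝ) (1/2), 0 ≤ η r := fun r hr => by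
    rw [hηh r hr]; exact hh.1 r (Ioo_subset_Ico_self hr)
  obtain ⟨T, hTm, hTΘ, hT0, hTpi⟩ := exists_measurable_Theta hη0 hηm hηh hΘ
  -- every point of the lower domain
  have hKx : ∀ x ∈ lowerDom, ((K x).1, (K x).2 * T (K x).1) ∈ polS T ∧
      polF η ((K x).1, (K x).2 * T (K x).1) = x := by
    intro x hx
    obtain ⟨hr, hθ⟩ := hK.1.mapsTo hx
    have h2 := hK.2 x hx
    refine ⟨⟨hr, ?_⟩, ?_⟩
    · simp only [abs_mul, abs_of_pos (hT0 _ hr)]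
      exact mul_le_of_le_one_left (hT0 _ hr).le (abs_le.2 hθ)
    · rw [← hTΘ _ hr, ← hηh _ hr] at h2
      exact Prod.ext h2.1.symm h2.2.symm
  have hFp : ∀ p ∈ polS T, polF η p ∈ lowerDom ∧ K (polF η p) = (p.1, p.2 / T p.1) := by
    rintro ⟨r, φ⟩ ⟨hr, hφ⟩
    dsimp only at hr hφ ⊢
    have hT := hT0 r hr
    have hmem : ((r, φ / T r) : ℝ × ℝ) ∈ Set.Ioo (0:ℝ) (1/2) ×ˢ Set.Icc (-1:ℝ) 1 := by
      refine ⟨hr, abs_le.1 ?_⟩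
      simp only [abs_div, abs_of_pos hT]
      exact (div_le_one hT).2 hφ
    obtain ⟨x, hx, hxK⟩ := hK.1.surjOn hmem
    have := (hKx x hx).2
    rw [hxK] at this
    simp only [div_mul_cancel₀ _ hT.ne'] at this
    rw [this]
    exact ⟨hx, hxK⟩
  have hF : InjOn (polF η) (polS T) := by
    intro p hp q hq hpq
    have h1 := (hFp p hp).2
    rw [hpq, (hFp q hq).2] at h1
    simp only [Prod.mk.injEq] at h1
    obtain ⟨h1, h2⟩ := h1
    rw [h1] at h2
    have hT := hT0 _ hp.1
    refine Prod.ext h1.symm ?_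
    field_simp at h2
    exact h2.symm
  have hBS : B ⊆ polF η '' polS T := fun x hx => ⟨_, hKx x (hBl hx)⟩
  set m : ℝ → ℝ := fun r => δ * ((1 + deriv h r) * T r - deriv h r * Real.sin (T r)) with hmdef
  have hdm : Measurable (deriv h) := measurable_deriv h
  have hm : Measurable m := by rw [hmdef]; fun_prop
  -- position of Ψ
  have hΨp : ∀ p ∈ polS T, (p.1, g p.1 (p.2 / T p.1) * T p.1) ∈ polS T ∧
      polF η (p.1, g p.1 (p.2 / T p.1) * T p.1) = Ψ (polF η p) := by
    intro p hp
    obtain ⟨h1, h2⟩ := hFp p hp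
    obtain ⟨h3, h4, h5⟩ := hΨ.1 _ h1
    have := hKx _ h3
    rw [h4, h5, h2] at this
    exact this
  have hsgn : ∀ p ∈ polS T, ((polF η p).1 ≤ 1/2 → p.2 ≤ 0) ∧ (1/2 < (polF η p).1 → 0 ≤ p.2) := by
    rintro ⟨r, φ⟩ ⟨hr, hφ⟩
    dsimp only at hr hφ
    have h1 := hη0 r hr
    have h2 := hr.1
    have h3 := hTpi r hr
    obtain ⟨h4, h5⟩ := abs_le.1 hφ
    have hpi := Real.pi_pos
    constructor
    · intro hx
      by_contra hc
      push Not at hc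
      have := Real.sin_pos_of_pos_of_lt_pi (x := φ) hc (by linarith)
      have : 0 < (r + η r) * Real.sin φ := by positivity
      simp only [polF] at hx; linarith
    · intro hx
      by_contra hc
      push Not at hc
      have := Real.sin_neg_of_neg_of_neg_pi_lt (x := φ) hc (by linarith)
      have : (r + η r) * Real.sin φ < 0 := mul_neg_of_pos_of_neg (by positivity) this
      simp only [polF] at hx; linarith
  have hL : MeasurableSet {x : ℝ × ℝ | x.1 ≤ 1/2} := measurableSet_le measurable_fst measurable_const
  have hR : MeasurableSet {x : ℝ × ℝ | 1/2 < x.1} := measurableSet_lt measurable_const measurable_fst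
  have hleft := key_volume (a := 1 + δ) (by linarith [hδ.1]) hηm hdm hTm hm hη0 hd0 hη hd hF
    (hB.inter hL) (inter_subset_left.trans hBS) Ψ (by
      intro p hp hpB
      refine ⟨_, (hΨp p hp).1, (hΨp p hp).2, ?_⟩
      have hp2 := (hsgn p hp).1 hpB.2
      have hT := hT0 _ hp.1
      have hl : p.2 / T p.1 ∈ Icc (-1:ℝ) 0 := by
        refine ⟨?_, div_nonpos_of_nonpos_of_nonneg hp2 hT.le⟩
        rw [le_div_iff₀ hT]; linarith [(abs_le.1 hp.2).1]
      have hgl := (hg p.1 hp.1).2.2.2.2.1 _ hl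
      have e1 := integral_wgt (h := h) (Θ := Θ) (r := p.1) (-1) (p.2 / T p.1)
      have e2 := integral_wgt (h := h) (Θ := Θ) (r := p.1) (-1) (g p.1 (p.2 / T p.1))
      rw [← hgl] at e2
      rw [← hTΘ _ hp.1] at e1 e2
      rw [div_mul_cancel₀ _ hT.ne', neg_one_mul, Real.sin_neg] at e1
      rw [neg_one_mul, Real.sin_neg] at e2
      simp only [areaQ, shearL, hmdef, Prod.mk.injEq, true_and]
      linear_combination (1 + δ) * e1 - e2)
  have hright := key_volume (a := 1 - δ) (by linarith [hδ.2]) hηm hdm hTm hm hη0 hd0 hη hd hF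
    (hB.inter hR) (inter_subset_left.trans hBS) Ψ (by
      intro p hp hpB
      refine ⟨_, (hΨp p hp).1, (hΨp p hp).2, ?_⟩
      have hp2 := (hsgn p hp).2 hpB.2
      have hT := hT0 _ hp.1
      have hl : p.2 / T p.1 ∈ Icc (0:ℝ) 1 := by
        refine ⟨div_nonneg hp2 hT.le, ?_⟩
        rw [div_le_one hT]; linarith [(abs_le.1 hp.2).2]
      have hgl := (hg p.1 hp.1).2.2.2.2.2 _ hl
      have e1 := integral_wgt (h := h) (Θ := Θ) (r := p.1) (p.2 / T p.1) 1
      have e2 := integral_wgt (h := h) (Θ := Θ) (r := p.1) (g p.1 (p.2 / T p.1)) 1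
      rw [← hgl] at e2
      rw [← hTΘ _ hp.1] at e1 e2
      rw [div_mul_cancel₀ _ hT.ne', one_mul] at e1
      rw [one_mul] at e2
      simp only [areaQ, shearL, hmdef, Prod.mk.injEq, true_and]
      linear_combination -(1 - δ) * e1 + e2)
  have hsplit : Ψ '' B = Ψ '' (B ∩ {x | x.1 ≤ 1/2}) ∪ Ψ '' (B ∩ {x | 1/2 < x.1}) := by
    rw [← image_union, ← inter_union_distrib_left]
    congr 1
    ext x
    simp [le_or_gt]
  have hinj : InjOn Ψ lowerDom := by
    intro x hx y hy hxy
    obtain ⟨-, a1, a2⟩ := hΨ.1 x hx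
    obtain ⟨-, b1, b2⟩ := hΨ.1 y hy
    rw [hxy] at a1 a2
    have c1 : (K x).1 = (K y).1 := by rw [← a1, b1]
    have c2 : g (K x).1 (K x).2 = g (K x).1 (K y).2 := by rw [← a2, b2, c1]
    have hkx := hK.1.mapsTo hx
    have hky := hK.1.mapsTo hy
    have c3 := (hg _ hkx.1).2.1.injOn hkx.2 hky.2 c2
    exact hK.1.injOn hx hy (Prod.ext c1 c3)
  have hdisj : Disjoint (Ψ '' (B ∩ {x | x.1 ≤ 1/2})) (Ψ '' (B ∩ {x | 1/2 < x.1})) := by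
    rw [Set.disjoint_left]
    rintro _ ⟨x, hx, rfl⟩ ⟨y, hy, hxy⟩
    have := hinj (hBl hy.1) (hBl hx.1) hxy
    subst this
    exact absurd (show y.1 ≤ 1/2 from hx.2) (not_le.2 hy.2)
  rw [hsplit, measure_union hdisj hright.1, hleft.2, hright.2]

theorem lower_full (h : ℝ → ℝ) (hh : GoodH h)
    (r₀ : ℝ) (Θ : ℝ → ℝ) (hΘ : GoodTheta h r₀ Θ)
    (K : ℝ × ℝ → ℝ × ℝ) (hK : GoodK h Θ K)
    (δ : ℝ) (hδ : δ ∈ Set.Ioo (-1:ℝ) 1)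
    (g : ℝ → ℝ → ℝ) (hg : IsGFamily h Θ δ g)
    (Ψ : ℝ × ℝ → ℝ × ℝ) (hΨ : IsPsi K δ g Ψ)
    (B : Set (ℝ × ℝ)) (hBl : B ⊆ Icc (0:ℝ) 1 ×ˢ Ico (0:ℝ) (1/2)) (hB : MeasurableSet B) :
    volume (Ψ '' B) = ENNReal.ofReal (1 + δ) * volume (B ∩ {x | x.1 ≤ 1/2})
        + ENNReal.ofReal (1 - δ) * volume (B ∩ {x | 1/2 < x.1}) := by
  set P : Set (ℝ × ℝ) := {((1/2 : ℝ), (0 : ℝ))}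
  have hP : volume P = 0 := measure_singleton _
  have h1 := lower_main h hh r₀ Θ hΘ K hK δ hδ g hg Ψ hΨ (B \ P)
    (fun x hx => ⟨hBl hx.1, hx.2⟩) (hB.diff (measurableSet_singleton _))
  have h2 : ∀ C : Set (ℝ × ℝ), volume ((B \ P) ∩ C) = volume (B ∩ C) := by
    intro C
    rw [← inter_sdiff_right_comm, measure_sdiff_null hP]
  have h3 : volume (Ψ '' B) = volume (Ψ '' (B \ P)) := by
    apply le_antisymm _ (measure_mono (image_mono sdiff_subset))
    calc volume (Ψ '' B) ≤ volume (Ψ '' (B \ P) ∪ P) := by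
          apply measure_mono
          rintro _ ⟨x, hx, rfl⟩
          by_cases hxP : x ∈ P
          · right
            rw [show x = (1/2, 0) from hxP, hΨ.2.1]; rfl
          · exact Or.inl ⟨x, ⟨hx, hxP⟩, rfl⟩
      _ ≤ _ := (measure_union_le _ _).trans (by rw [hP, add_zero])
  rw [h3, h1, h2, h2]

theorem split_snd (A : Set (ℝ × ℝ)) :
    volume A = volume (A ∩ {x | x.2 < 1/2}) + volume (A ∩ {x | 1/2 < x.2}) := by
  have hL : MeasurableSet {x : ℝ × ℝ | x.2 < 1/2} := measurableSet_lt measurable_snd measurable_const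
  rw [← measure_inter_add_sdiff A hL]
  congr 1
  apply le_antisymm
  · calc volume (A \ {x | x.2 < 1/2})
        ≤ volume ((A ∩ {x | 1/2 < x.2}) ∪ {x : ℝ × ℝ | x.2 = 1/2}) := by
          apply measure_mono
          rintro x ⟨hx, hx2⟩
          simp only [mem_ofPred_eq, not_lt] at hx2
          rcases hx2.lt_or_eq with h | h
          · exact Or.inl ⟨hx, h⟩
          · exact Or.inr h.symm
      _ ≤ _ := (measure_union_le _ _).trans (by rw [line_snd_null, add_zero])
  · apply measure_mono
    rintro x ⟨hx, hx2⟩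
    exact ⟨hx, fun hc => lt_asymm (show x.2 < 1/2 from hc) hx2⟩

theorem stmt_3 (h : ℝ → ℝ) (hh : GoodH h)
    (r₀ : ℝ) (hr₀ : r₀ ∈ Set.Ioo (0:ℝ) (1/2)) (hr₀eq : 2 * r₀ * h r₀ + r₀ ^ 2 = 1/4)
    (Θ : ℝ → ℝ) (hΘ : GoodTheta h r₀ Θ)
    (K : ℝ × ℝ → ℝ × ℝ) (hK : GoodK h Θ K)
    (δ : ℝ) (hδ : δ ∈ Set.Ioo (-1:ℝ) 1)
    (g : ℝ → ℝ → ℝ) (hg : IsGFamily h Θ δ g)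
    (Ψ : ℝ × ℝ → ℝ × ℝ) (hΨ : IsPsi K δ g Ψ) :
    (∀ B : Set (ℝ × ℝ), B ⊆ unitSq → MeasurableSet B →
      volume (Ψ '' B) = ENNReal.ofReal (1 + δ) * volume (B ∩ leftHalf)
        + ENNReal.ofReal (1 - δ) * volume (B ∩ rightHalf)) ∧
    volume (Ψ '' leftHalf) = ENNReal.ofReal (1 + δ) * volume leftHalf ∧
    volume (Ψ '' leftHalf) = ENNReal.ofReal ((1 + δ) / 2) := by
  have main : ∀ B : Set (ℝ × ℝ), B ⊆ unitSq → MeasurableSet B →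
      volume (Ψ '' B) = ENNReal.ofReal (1 + δ) * volume (B ∩ leftHalf)
        + ENNReal.ofReal (1 - δ) * volume (B ∩ rightHalf) := by
    intro B hBs hB
    have hL : MeasurableSet {x : ℝ × ℝ | x.2 < 1/2} :=
      measurableSet_lt measurable_snd measurable_const
    have hU : MeasurableSet {x : ℝ × ℝ | 1/2 < x.2} :=
      measurableSet_lt measurable_const measurable_snd
    -- images stay in their halves
    have hlow : ∀ x ∈ unitSq, x.2 < 1/2 → (Ψ x).2 < 1/2 := by
      intro x hx hx2
      by_cases hxP : x = (1/2, 0)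
      · rw [hxP, hΨ.2.1]; norm_num
      · exact (hΨ.1 x ⟨⟨hx.1, hx.2.1, hx2⟩, hxP⟩).1.1.2.2
    have hmid : ∀ x ∈ unitSq, x.2 = 1/2 → (Ψ x).2 = 1/2 := by
      rintro ⟨x1, x2⟩ hx hx2
      dsimp only at hx2
      subst hx2
      rcases le_total x1 (1/2) with h1 | h1
      · rw [hΨ.2.2.2.1 x1 hx.1.1 h1]
      · rw [hΨ.2.2.2.2 x1 h1 hx.1.2]
    have hrefl : ∀ x ∈ unitSq, reflV x ∈ unitSq := by
      rintro x ⟨h1, h2, h3⟩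
      exact ⟨h1, by simp only [reflV]; linarith, by simp only [reflV]; linarith⟩
    have hupΨ : ∀ x ∈ unitSq, 1/2 < x.2 → Ψ x = reflV (Ψ (reflV x)) := fun x hx hx2 =>
      hΨ.2.2.1 x hx hx2
    have hup : ∀ x ∈ unitSq, 1/2 < x.2 → 1/2 < (Ψ x).2 := by
      intro x hx hx2
      rw [hupΨ x hx hx2]
      have := hlow (reflV x) (hrefl x hx) (by simp only [reflV]; linarith)
      simp only [reflV] at this ⊢
      linarith
    have e1 : Ψ '' B ∩ {x | x.2 < 1/2} = Ψ '' (B ∩ {x | x.2 < 1/2}) := by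
      ext y; constructor
      · rintro ⟨⟨x, hx, rfl⟩, hy⟩
        refine ⟨x, ⟨hx, ?_⟩, rfl⟩
        simp only [mem_ofPred_eq] at hy ⊢
        rcases lt_trichotomy x.2 (1/2) with h1 | h1 | h1
        · exact h1
        · linarith [hmid x (hBs hx) h1]
        · linarith [hup x (hBs hx) h1]
      · rintro ⟨x, ⟨hx, hx2⟩, rfl⟩
        exact ⟨⟨x, hx, rfl⟩, hlow x (hBs hx) hx2⟩
    have e2 : Ψ '' B ∩ {x | 1/2 < x.2} =
        reflV '' (Ψ '' (reflV '' (B ∩ {x | 1/2 < x.2}))) := by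
      ext y; constructor
      · rintro ⟨⟨x, hx, rfl⟩, hy⟩
        have hx2 : 1/2 < x.2 := by
          simp only [mem_ofPred_eq] at hy
          rcases lt_trichotomy x.2 (1/2) with h1 | h1 | h1
          · linarith [hlow x (hBs hx) h1]
          · linarith [hmid x (hBs hx) h1]
          · exact h1
        exact ⟨_, ⟨_, ⟨x, ⟨hx, hx2⟩, rfl⟩, rfl⟩, (hupΨ x (hBs hx) hx2).symm⟩
      · rintro ⟨_, ⟨_, ⟨x, ⟨hx, hx2⟩, rfl⟩, rfl⟩, rfl⟩
        rw [← hupΨ x (hBs hx) hx2]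
        exact ⟨⟨x, hx, rfl⟩, hup x (hBs hx) hx2⟩
    have f1 := lower_full h hh r₀ Θ hΘ K hK δ hδ g hg Ψ hΨ (B ∩ {x | x.2 < 1/2})
      (fun x hx => ⟨(hBs hx.1).1, (hBs hx.1).2.1, hx.2⟩) (hB.inter hL)
    have f2 := lower_full h hh r₀ Θ hΘ K hK δ hδ g hg Ψ hΨ (reflV '' (B ∩ {x | 1/2 < x.2}))
      (by
        rintro _ ⟨x, ⟨hx, hx2⟩, rfl⟩
        have := hrefl x (hBs hx)
        simp only [mem_ofPred_eq] at hx2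
        exact ⟨this.1, this.2.1, by simp only [reflV]; linarith⟩)
      (by rw [reflV_image]; exact measurable_reflV (hB.inter hU))
    have f3 : ∀ C : Set ℝ, volume (reflV '' (B ∩ {x | 1/2 < x.2}) ∩ {x | x.1 ∈ C}) =
        volume (B ∩ {x | x.1 ∈ C} ∩ {x | 1/2 < x.2}) := by
      intro C
      rw [← volume_reflV (B ∩ {x | x.1 ∈ C} ∩ {x | 1/2 < x.2})]
      congr 1
      ext y
      simp only [reflV_image, mem_inter_iff, mem_preimage, mem_ofPred_eq, reflV]
      tauto
    have f3a := f3 (Iic (1/2))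
    have f3b := f3 (Ioi (1/2))
    simp only [mem_Iic, mem_Ioi] at f3a f3b
    have gl : B ∩ leftHalf = B ∩ {x | x.1 ≤ 1/2} := by
      ext x; constructor
      · rintro ⟨hx, h1⟩; exact ⟨hx, h1.1.2⟩
      · rintro ⟨hx, h1⟩; exact ⟨hx, ⟨(hBs hx).1.1, h1⟩, (hBs hx).2⟩
    have gr : volume (B ∩ rightHalf) = volume (B ∩ {x | 1/2 < x.1}) := by
      apply le_antisymm
      · calc volume (B ∩ rightHalf)
            ≤ volume ((B ∩ {x | 1/2 < x.1}) ∪ {x : ℝ × ℝ | x.1 = 1/2}) := by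
              apply measure_mono
              rintro x ⟨hx, hx2⟩
              rcases hx2.1.1.lt_or_eq with h | h
              · exact Or.inl ⟨hx, h⟩
              · exact Or.inr h.symm
          _ ≤ _ := (measure_union_le _ _).trans (by rw [line_fst_null, add_zero])
      · apply measure_mono
        rintro x ⟨hx, h1⟩
        exact ⟨hx, ⟨le_of_lt h1, (hBs hx).1.2⟩, (hBs hx).2⟩
    rw [split_snd (Ψ '' B), e1, e2, volume_reflV, f1, f2, f3a, f3b, gl, gr,
      split_snd (B ∩ {x | x.1 ≤ 1/2}), split_snd (B ∩ {x | 1/2 < x.1}),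
      inter_right_comm B {x | x.2 < 1/2}, inter_right_comm B {x | x.2 < 1/2}]
    ring
  have hvol : volume leftHalf = ENNReal.ofReal (1/2) := by
    unfold leftHalf
    rw [Measure.volume_eq_prod, Measure.prod_prod]
    simp
  have hl : volume (Ψ '' leftHalf) = ENNReal.ofReal (1 + δ) * volume leftHalf := by
    rw [main leftHalf ?_ ?_, inter_self]
    · have : volume (leftHalf ∩ rightHalf) = 0 := by
        refine measure_mono_null ?_ (line_fst_null (1/2))
        rintro x ⟨h1, h2⟩
        exact le_antisymm h1.1.2 h2.1.1
      rw [this, mul_zero, add_zero]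
    · rintro x ⟨h1, h2⟩
      exact ⟨⟨h1.1, by linarith [h1.2]⟩, h2⟩
    · exact measurableSet_Icc.prod measurableSet_Icc
  refine ⟨main, hl, ?_⟩
  rw [hl, hvol, ← ENNReal.ofReal_mul (by linarith [hδ.1])]
  congr 1; ring
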